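/- arXiv:1605.06786 — 4 statements merged into one kernel-verified Lean document; each statement's English description precedes it below -/
import Mathlib

section
/- Let n ≥ 1, let U be an n×n complex unitary matrix, let P = (Q_1,…,Q_m) be a POVM on ℂ^n and let l ∈ ℕ. If the real linear span of the set of matrices { U^j Q_i (U*)^j : 1 ≤ i ≤ m, 0 ≤ j ≤ l−1 } equals all of H(n), then m ≥ n. -/
open Matrix
open scoped ComplexOrder

/-- A POVM with `m` outcomes on `ℂ^n`: a tuple of positive semidefinite matrices summing to `1`. -/
def IsPOVM {n m : ℕ} (Q : Fin m → Matrix (Fin n) (Fin n) ℂ) : Prop :=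
  (∀ i, (Q i).PosSemidef) ∧ ∑ i, Q i = 1

lemma exists_eigenbasis {n : ℕ} (U : Matrix (Fin n) (Fin n) ℂ)
    (hU : U ∈ Matrix.unitaryGroup (Fin n) ℂ) :
    ∃ (ι : Type) (_ : Fintype ι) (b : Module.Basis ι ℂ (EuclideanSpace ℂ (Fin n))),
      ∀ k, ∃ μ : ℂ, Matrix.toEuclideanLin U (b k) = μ • b k := by
  classical
  have h1 : Uᴴ * U = 1 := by simpa [Matrix.star_eq_conjTranspose] using hU.1
  have h2 : U * Uᴴ = 1 := by simpa [Matrix.star_eq_conjTranspose] using hU.2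
  set A : Matrix (Fin n) (Fin n) ℂ := U + Uᴴ with hA
  set B : Matrix (Fin n) (Fin n) ℂ := Complex.I • (U - Uᴴ) with hB
  have hAh : A.IsHermitian := by
    simp [Matrix.IsHermitian, hA, add_comm]
  have hBh : B.IsHermitian := by
    simp [Matrix.IsHermitian, hB, Matrix.conjTranspose_smul, ← smul_neg]
  have hAB : A * B = B * A := by
    simp only [hA, hB, Matrix.mul_smul, Matrix.smul_mul, Matrix.add_mul, Matrix.mul_sub,
      Matrix.sub_mul, Matrix.mul_add, h1, h2]
    rw [← smul_add]; congr 1; abel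
  have hs := LinearMap.IsSymmetric.iSup_iSup_eigenspace_inf_eigenspace_eq_top_of_commute
    (Matrix.isHermitian_iff_isSymmetric.1 hAh) (Matrix.isHermitian_iff_isSymmetric.1 hBh)
    (by
      refine LinearMap.ext fun v => ?_
      apply (WithLp.equiv 2 (Fin n → ℂ)).injective
      simp [Matrix.toLpLin_apply, hAB])
  let S : Set (EuclideanSpace ℂ (Fin n)) :=
    {v | ∃ μ : ℂ, Matrix.toEuclideanLin U v = μ • v}
  have hS : ⊤ ≤ Submodule.span ℂ S := by
    rw [← hs]
    refine iSup_le fun α => iSup_le fun γ => ?_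
    rintro v ⟨hv1, hv2⟩
    apply Submodule.subset_span
    have hv1' := Module.End.mem_eigenspace_iff.1 hv1
    have hv2' := Module.End.mem_eigenspace_iff.1 hv2
    refine ⟨(1/2 : ℂ) * (α - Complex.I * γ), ?_⟩
    have hUe : U = (1/2 : ℂ) • (A - Complex.I • B) := by
      simp only [hA, hB, smul_smul, Complex.I_mul_I]
      ext i j
      simp
      ring
    rw [hUe, map_smul, map_sub, map_smul, LinearMap.smul_apply, LinearMap.sub_apply,
      LinearMap.smul_apply, hv1', hv2', smul_smul, ← sub_smul, smul_smul]
  refine ⟨_, ?_, Module.Basis.ofSpan hS, fun k => ?_⟩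
  · exact FiniteDimensional.fintypeBasisIndex (Module.Basis.ofSpan hS)
  · exact Module.Basis.ofSpan_subset hS ⟨k, rfl⟩

/-- If the real span of `{U^j Q_i (U*)^j : 1 ≤ i ≤ m, 0 ≤ j ≤ l-1}` is all of
`H(n)`, then `m ≥ n`. -/
theorem stmt0 {n m l : ℕ} (hn : 1 ≤ n) (U : Matrix (Fin n) (Fin n) ℂ)
    (hU : U ∈ Matrix.unitaryGroup (Fin n) ℂ)
    (Q : Fin m → Matrix (Fin n) (Fin n) ℂ) (hQ : IsPOVM Q)
    (hspan : Submodule.span ℝ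
        {X : Matrix (Fin n) (Fin n) ℂ | ∃ (i : Fin m) (j : ℕ), j < l ∧ X = U ^ j * Q i * Uᴴ ^ j}
      = selfAdjoint.submodule ℝ (Matrix (Fin n) (Fin n) ℂ)) :
    n ≤ m := by
  classical
  obtain ⟨ι, _, b, hb⟩ := exists_eigenbasis U hU
  choose μ hμ using hb
  have h1 : Uᴴ * U = 1 := by simpa [Matrix.star_eq_conjTranspose] using hU.1
  have hmul : ∀ (X Y : Matrix (Fin n) (Fin n) ℂ) v, Matrix.toEuclideanLin (X * Y) v =
      Matrix.toEuclideanLin X (Matrix.toEuclideanLin Y v) := by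
    intro X Y v
    apply (WithLp.equiv 2 (Fin n → ℂ)).injective
    simp [Matrix.toLpLin_apply]
  have hone : ∀ v, Matrix.toEuclideanLin (1 : Matrix (Fin n) (Fin n) ℂ) v = v := by
    intro v
    apply (WithLp.equiv 2 (Fin n → ℂ)).injective
    simp [Matrix.toLpLin_apply]
  let φ : Matrix (Fin n) (Fin n) ℂ →ₗ[ℂ] (ι → ℂ) :=
    { toFun := fun X k => b.repr (Matrix.toEuclideanLin X (b k)) k
      map_add' := fun X Y => by ext k; simp
      map_smul' := fun c X => by ext k; simp }
  have hφ : ∀ X k, φ X k = b.repr (Matrix.toEuclideanLin X (b k)) k := fun _ _ => rfl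
  have hcoord : ∀ k v, b.repr (Matrix.toEuclideanLin U v) k = μ k * b.repr v k := by
    intro k v
    have : b.coord k ∘ₗ Matrix.toEuclideanLin U = μ k • b.coord k := by
      refine b.ext fun i => ?_
      by_cases h : i = k
      · subst h; simp [hμ]
      · simp [hμ, h]
    simpa using LinearMap.congr_fun this v
  have hinv : ∀ k, μ k • Matrix.toEuclideanLin Uᴴ (b k) = b k := by
    intro k
    rw [← map_smul, ← hμ, ← hmul, h1, hone]
  have hstep : ∀ X, φ (U * X * Uᴴ) = φ X := by
    intro X
    ext k
    rw [hφ, hφ, hmul, hmul, hcoord]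
    conv_rhs => rw [← hinv k]
    simp
  have hpow : ∀ X (j : ℕ), φ (U ^ j * X * Uᴴ ^ j) = φ X := by
    intro X j
    induction j with
    | zero => simp
    | succ j ih =>
      rw [← ih, ← hstep (U ^ j * X * Uᴴ ^ j), pow_succ' U, pow_succ Uᴴ]
      simp only [Matrix.mul_assoc]
  have hsurj : Function.Surjective φ := by
    intro c
    refine ⟨Matrix.toEuclideanLin.symm (b.constr ℂ fun k => c k • b k), ?_⟩
    ext k
    simp [hφ]
  let S : Submodule ℂ (ι → ℂ) := Submodule.span ℂ (Set.range fun i => φ (Q i))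
  have hH : ∀ X, X ∈ selfAdjoint.submodule ℝ (Matrix (Fin n) (Fin n) ℂ) → φ X ∈ S := by
    intro X hX
    rw [← hspan] at hX
    have hle : Submodule.span ℝ
        {X : Matrix (Fin n) (Fin n) ℂ | ∃ (i : Fin m) (j : ℕ), j < l ∧ X = U ^ j * Q i * Uᴴ ^ j}
        ≤ (S.comap φ).restrictScalars ℝ := by
      rw [Submodule.span_le]
      rintro _ ⟨i, j, -, rfl⟩
      change φ _ ∈ S
      rw [hpow]
      exact Submodule.subset_span ⟨i, rfl⟩
    exact hle hX
  have htop : S = ⊤ := by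
    rw [eq_top_iff]
    rintro c -
    obtain ⟨X, rfl⟩ := hsurj c
    rw [← realPart_add_I_smul_imaginaryPart X, map_add, map_smul]
    exact S.add_mem (hH _ (realPart X).2) (S.smul_mem _ (hH _ (imaginaryPart X).2))
  have hc := finrank_range_le_card (R := ℂ) (fun i => φ (Q i))
  have hcard : Fintype.card ι = n := by
    rw [← Module.finrank_eq_card_basis b]; simp
  rw [Set.finrank, show Submodule.span ℂ (Set.range fun i => φ (Q i)) = ⊤ from htop,
    finrank_top] at hc
  simpa [hcard] using hc
end

section
/- Let U be a feasible n×n unitary matrix. Then for almost all POVMs P = (Q_1,…,Q_{n+1}) with n+1 outcomes, the measurement scheme obtained by measuring P at the n time steps j = 0,…,n−1 of the evolution X ↦ U X U* is informationally complete; that is, the map sending a quantum state ρ to the vector (tr(U^j Q_i (U*)^j ρ)) indexed by 1 ≤ i ≤ n+1, 0 ≤ j ≤ n−1 is injective on the set of all quantum states on ℂ^n. -/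
open Matrix MeasureTheory
open scoped ComplexOrder

instance {m n α : Type*} [MeasurableSpace α] : MeasurableSpace (Matrix m n α) :=
  inferInstanceAs (MeasurableSpace (m → n → α))

/-- A quantum state on `ℂ^n`: a positive semidefinite matrix of trace one. -/
def IsState {n : ℕ} (ρ : Matrix (Fin n) (Fin n) ℂ) : Prop :=
  ρ.PosSemidef ∧ ρ.trace = 1

/-- A unitary `U` is feasible iff, writing `U = V diag(λ) V*` with `V` unitary, the `n²−n`
products `conj(λ_i)·λ_j` over ordered pairs `(i,j)` with `i ≠ j` are pairwise distinct. -/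
def UnitaryFeasible {n : ℕ} (U : Matrix (Fin n) (Fin n) ℂ) : Prop :=
  ∃ (V : Matrix (Fin n) (Fin n) ℂ) (lam : Fin n → ℂ),
    V ∈ Matrix.unitaryGroup (Fin n) ℂ ∧ U = V * Matrix.diagonal lam * Vᴴ ∧
    ∀ i j i' j' : Fin n, i ≠ j → i' ≠ j' →
      starRingEnd ℂ (lam i) * lam j = starRingEnd ℂ (lam i') * lam j' → i = i' ∧ j = j'

/-- The POVM with `m+1` outcomes obtained from the first `m` effects `Q_1, …, Q_m` by appending
the remaining effect `1 − ∑ Q_i`; this realizes the identification of POVMs with `m+1` outcomes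
with a subset of `H(n)^m`. -/
noncomputable def povmExt {n m : ℕ} (Q : Fin m → selfAdjoint (Matrix (Fin n) (Fin n) ℂ)) :
    Fin (m + 1) → Matrix (Fin n) (Fin n) ℂ :=
  Fin.snoc (fun i => (Q i : Matrix (Fin n) (Fin n) ℂ))
    (1 - ∑ i, (Q i : Matrix (Fin n) (Fin n) ℂ))

open Polynomial in
/-- Determinant pencil: only finitely many zeros. -/
lemma pencil_finite {ι : Type*} [Fintype ι] [DecidableEq ι] (A B : Matrix ι ι ℂ) (s₀ : ℂ)
    (h : (A + s₀ • B).det ≠ 0) : {s : ℂ | (A + s • B).det = 0}.Finite := by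
  set M : Matrix ι ι ℂ[X] := A.map C + (X : ℂ[X]) • B.map C with hM
  have hev : ∀ s, M.det.eval s = (A + s • B).det := by
    intro s
    rw [← Polynomial.coe_evalRingHom, RingHom.map_det]
    congr 1
    ext i j
    simp [hM]
    exact mul_comm _ _
  have hne : M.det ≠ 0 := by
    intro h0
    apply h
    rw [← hev, h0, Polynomial.eval_zero]
  refine (M.det.roots.toFinset.finite_toSet).subset ?_
  intro s hs
  simp only [Finset.mem_coe, Multiset.mem_toFinset]
  rw [Polynomial.mem_roots hne, Polynomial.IsRoot, hev]
  exact hs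

open Polynomial in
lemma pencil_exists {ι : Type*} [Fintype ι] [DecidableEq ι] (A B : Matrix ι ι ℂ)
    (h : B.det ≠ 0) : ∃ s₀ : ℂ, (A + s₀ • B).det ≠ 0 := by
  have h1 : (B + (0 : ℂ) • A).det ≠ 0 := by simpa using h
  have hf := pencil_finite B A 0 h1
  have hinf : (Set.univ : Set ℂ).Infinite := Set.infinite_univ
  obtain ⟨s, hs⟩ := ((hf.union (Set.finite_singleton 0)).infinite_compl).nonempty
  simp only [Set.mem_compl_iff, Set.mem_union, Set.mem_ofPred_eq, Set.mem_singleton_iff,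
    not_or] at hs
  refine ⟨s⁻¹, ?_⟩
  have : A + s⁻¹ • B = s⁻¹ • (B + s • A) := by
    rw [smul_add, smul_smul, inv_mul_cancel₀ hs.2, one_smul, add_comm]
  rw [this, Matrix.det_smul]
  exact mul_ne_zero (pow_ne_zero _ (inv_ne_zero hs.2)) hs.1

lemma pencil_real_finite {ι : Type*} [Fintype ι] [DecidableEq ι] (A B : Matrix ι ι ℂ) (s₀ : ℂ)
    (h : (A + s₀ • B).det ≠ 0) : {s : ℝ | (A + (s : ℂ) • B).det = 0}.Finite :=
  (pencil_finite A B s₀ h).preimage (Complex.ofReal_injective.injOn)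

/-- The measurement matrix. -/
noncomputable def MM {n : ℕ} (U : Matrix (Fin n) (Fin n) ℂ)
    (Q : Fin n → Matrix (Fin n) (Fin n) ℂ) :
    Matrix (Fin n × Fin n) (Fin n × Fin n) ℂ :=
  fun p q => (U ^ (p.2 : ℕ) * Q p.1 * Uᴴ ^ (p.2 : ℕ)) q.1 q.2

lemma MM_add_smul {n : ℕ} (U : Matrix (Fin n) (Fin n) ℂ)
    (A B : Fin n → Matrix (Fin n) (Fin n) ℂ) (s : ℂ) :
    MM U (fun i => A i + s • B i) = MM U A + s • MM U B := by
  ext p q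
  simp [MM, Matrix.mul_add, Matrix.add_mul]

lemma MM_mulVec {n : ℕ} (U : Matrix (Fin n) (Fin n) ℂ)
    (Q : Fin n → Matrix (Fin n) (Fin n) ℂ) (X : Matrix (Fin n) (Fin n) ℂ) (p : Fin n × Fin n) :
    (MM U Q *ᵥ (fun q => X q.2 q.1)) p =
      (U ^ (p.2 : ℕ) * Q p.1 * Uᴴ ^ (p.2 : ℕ) * X).trace := by
  simp only [Matrix.mulVec, dotProduct, MM, Matrix.trace, Matrix.diag]
  rw [Fintype.sum_prod_type]
  rfl

lemma MM_inj {n : ℕ} (U : Matrix (Fin n) (Fin n) ℂ)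
    (Q : Fin n → Matrix (Fin n) (Fin n) ℂ) (h : (MM U Q).det ≠ 0)
    (X : Matrix (Fin n) (Fin n) ℂ)
    (hX : ∀ i j : Fin n, (U ^ (j : ℕ) * Q i * Uᴴ ^ (j : ℕ) * X).trace = 0) : X = 0 := by
  have := Matrix.eq_zero_of_mulVec_eq_zero h (v := fun q => X q.2 q.1)
    (by ext p; rw [MM_mulVec]; exact hX _ _)
  ext a b
  exact congrFun this (b, a)

lemma exists_W {n : ℕ} (U : Matrix (Fin n) (Fin n) ℂ)
    (hU : U ∈ Matrix.unitaryGroup (Fin n) ℂ) (hfeas : UnitaryFeasible U) :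
    ∃ W : Fin n → Matrix (Fin n) (Fin n) ℂ, (MM U W).det ≠ 0 := by
  obtain ⟨V, lam, hV, hUV, hl⟩ := hfeas
  have hV1 : Vᴴ * V = 1 := Matrix.mem_unitaryGroup_iff'.1 hV
  have hV2 : V * Vᴴ = 1 := Matrix.mem_unitaryGroup_iff.1 hV
  have hinj : Function.Injective lam := by
    intro a b hab
    by_contra hne
    exact hne (hl a b b a hne (Ne.symm hne) (by rw [hab])).1
  have hD : Matrix.diagonal lam = Vᴴ * U * V := by
    rw [hUV]
    simp only [Matrix.mul_assoc]
    rw [hV1, Matrix.mul_one, ← Matrix.mul_assoc, hV1, Matrix.one_mul]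
  have hU1 : U * Uᴴ = 1 := Matrix.mem_unitaryGroup_iff.1 hU
  have hlam : ∀ a, lam a ≠ 0 := by
    have hDD : Matrix.diagonal lam * (Matrix.diagonal lam)ᴴ = 1 := by
      rw [hD]
      simp only [Matrix.conjTranspose_mul, Matrix.conjTranspose_conjTranspose]
      calc Vᴴ * U * V * (Vᴴ * (Uᴴ * V)) = Vᴴ * (U * (V * Vᴴ) * Uᴴ) * V := by
            simp only [Matrix.mul_assoc]
        _ = 1 := by rw [hV2, Matrix.mul_one, hU1, Matrix.mul_one, hV1]
    intro a ha
    have := congrFun (congrFun hDD a) a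
    simp [Matrix.diagonal_conjTranspose, ha] at this
  have hpow : ∀ j : ℕ, U ^ j = V * Matrix.diagonal (fun a => lam a ^ j) * Vᴴ := by
    intro j
    induction j with
    | zero => simp [hV2]
    | succ k ih =>
      rw [pow_succ, ih]
      conv_lhs => rw [hUV]
      calc _ = V * Matrix.diagonal (fun a => lam a ^ k) * (Vᴴ * V) * Matrix.diagonal lam * Vᴴ := by
            simp only [Matrix.mul_assoc]
        _ = V * (Matrix.diagonal (fun a => lam a ^ k) * Matrix.diagonal lam) * Vᴴ := by
            rw [hV1, Matrix.mul_one]; simp only [Matrix.mul_assoc]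
        _ = _ := by rw [Matrix.diagonal_mul_diagonal]; simp only [pow_succ]
  have hpow' : ∀ j : ℕ, Uᴴ ^ j = V * Matrix.diagonal (fun a => star (lam a) ^ j) * Vᴴ := by
    intro j
    rw [← Matrix.conjTranspose_pow, hpow]
    simp only [Matrix.conjTranspose_mul, Matrix.conjTranspose_conjTranspose,
      Matrix.diagonal_conjTranspose, Matrix.mul_assoc]
    congr 3
    ext a
    simp
  let E : Fin n → Matrix (Fin n) (Fin n) ℂ := fun i => Matrix.of fun a _ => if a = i then 1 else 0
  refine ⟨fun i => V * E i * Vᴴ, ?_⟩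
  intro hdet
  obtain ⟨v, hv0, hv⟩ := Matrix.exists_mulVec_eq_zero_iff.2 hdet
  apply hv0
  set X : Matrix (Fin n) (Fin n) ℂ := Matrix.of fun a b => v (b, a) with hX
  have hvX : v = fun q => X q.2 q.1 := by ext q; rfl
  set Y := Vᴴ * X * V with hY
  have key : ∀ i j : Fin n, ∑ b, Y b i * (lam i * star (lam b)) ^ (j : ℕ) = 0 := by
    intro i j
    have h1 := congrFun hv (i, j)
    rw [hvX, MM_mulVec] at h1
    simp only [Pi.zero_apply] at h1
    rw [← h1, hpow, hpow']
    have : V * Matrix.diagonal (fun a => lam a ^ (j : ℕ)) * Vᴴ * (V * E i * Vᴴ) *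
        (V * Matrix.diagonal (fun a => star (lam a) ^ (j : ℕ)) * Vᴴ) * X =
        V * (Matrix.diagonal (fun a => lam a ^ (j : ℕ)) * E i *
          Matrix.diagonal (fun a => star (lam a) ^ (j : ℕ)) * (Vᴴ * X)) := by
      calc _ = V * Matrix.diagonal (fun a => lam a ^ (j : ℕ)) * (Vᴴ * V) * E i * (Vᴴ *
        V) * Matrix.diagonal (fun a => star (lam a) ^ (j : ℕ)) * Vᴴ * X := by
            simp only [Matrix.mul_assoc]
        _ = _ := by rw [hV1, Matrix.mul_one, Matrix.mul_one]; simp only [Matrix.mul_assoc]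
    rw [this, Matrix.trace_mul_comm, Matrix.mul_assoc, ← hY]
    simp only [Matrix.trace, Matrix.diag]
    symm
    rw [Finset.sum_eq_single i]
    · rw [Matrix.mul_apply]
      refine Finset.sum_congr rfl fun b _ => ?_
      simp [E, Matrix.mul_diagonal, Matrix.diagonal_mul, mul_pow]
      ring
    · intro a _ ha
      rw [Matrix.mul_apply]
      refine Finset.sum_eq_zero fun b _ => ?_
      simp [E, Matrix.mul_diagonal, Matrix.diagonal_mul, ha]
    · simp
  have hY0 : Y = 0 := by
    ext b i
    have hinj' : Function.Injective (fun b => lam i * star (lam b)) := by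
      intro b b' h
      exact hinj (star_injective (mul_left_cancel₀ (hlam i) h))
    exact congrFun (Matrix.eq_zero_of_forall_pow_sum_mul_pow_eq_zero hinj'
      (v := fun b => Y b i) (key i)) b
  have hX0 : X = 0 := by
    calc X = (V * Vᴴ) * X * (V * Vᴴ) := by rw [hV2, Matrix.one_mul, Matrix.mul_one]
      _ = V * Y * Vᴴ := by rw [hY]; simp only [Matrix.mul_assoc]
      _ = 0 := by rw [hY0]; simp
  rw [hvX, hX0]
  rfl

lemma exists_herm {n : ℕ} (U : Matrix (Fin n) (Fin n) ℂ)
    (hU : U ∈ Matrix.unitaryGroup (Fin n) ℂ) (hfeas : UnitaryFeasible U) :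
    ∃ R : Fin n → selfAdjoint (Matrix (Fin n) (Fin n) ℂ), (MM U (fun i => (R i).1)).det ≠ 0 := by
  obtain ⟨W, hW⟩ := exists_W U hU hfeas
  have h1 : W = fun i => (realPart (W i)).1 + Complex.I • (imaginaryPart (W i)).1 := by
    ext1 i
    exact (realPart_add_I_smul_imaginaryPart (W i)).symm
  rw [h1, MM_add_smul] at hW
  obtain ⟨s, hs⟩ := (pencil_real_finite _ _ _ hW).infinite_compl.nonempty
  refine ⟨fun i => realPart (W i) + s • imaginaryPart (W i), ?_⟩
  have : (fun i => (realPart (W i) + s • imaginaryPart (W i)).1) =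
      fun i => (realPart (W i)).1 + (s : ℂ) • (imaginaryPart (W i)).1 := by
    ext i a b
    simp
  rw [this, MM_add_smul]
  exact hs

lemma null_of_lines {E : Type*} [NormedAddCommGroup E] [NormedSpace ℝ E] [MeasurableSpace E]
    [BorelSpace E] [FiniteDimensional ℝ E] (μ : Measure E) [μ.IsAddHaarMeasure]
    (S : Set E) (hS : IsClosed S) (v : E) (h : ∀ y, {t : ℝ | y + t • v ∈ S}.Finite) :
    μ S = 0 := by
  have : LocallyCompactSpace E := by
    have := FiniteDimensional.proper ℝ E
    infer_instance
  have := MeasureTheory.ae_mem_of_ae_add_linearMap_mem (LinearMap.toSpanSingleton ℝ E v)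
    (volume : Measure ℝ) μ (s := Sᶜ) hS.measurableSet.compl (by
      intro y
      rw [ae_iff]
      refine Set.Finite.measure_zero ?_ _
      simpa using h y)
  rw [ae_iff] at this
  simpa using this

lemma null_of_lines' {E : Type*} [AddCommGroup E] [TopologicalSpace E] [IsTopologicalAddGroup E]
    [T2Space E] [Module ℝ E] [ContinuousSMul ℝ E] [MeasurableSpace E]
    [BorelSpace E] [FiniteDimensional ℝ E] (μ : Measure E) [μ.IsAddHaarMeasure]
    (S : Set E) (hS : IsClosed S) (v : E) (h : ∀ y, {t : ℝ | y + t • v ∈ S}.Finite) :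
    μ S = 0 := by
  let e : E ≃L[ℝ] (Fin (Module.finrank ℝ E) → ℝ) :=
    (Module.finBasis ℝ E).equivFun.toContinuousLinearEquiv
  have hH : (μ.map e).IsAddHaarMeasure := e.isAddHaarMeasure_map μ
  have hcl : IsClosed (e.symm ⁻¹' S) := hS.preimage e.symm.continuous
  have h1 := null_of_lines (μ.map e) (e.symm ⁻¹' S) hcl (e v) (by
    intro y
    simpa using h (e.symm y))
  rw [Measure.map_apply e.continuous.measurable hcl.measurableSet] at h1
  simpa [← Set.preimage_comp] using h1


lemma null_bad {n : ℕ} (U : Matrix (Fin n) (Fin n) ℂ)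
    (hU : U ∈ Matrix.unitaryGroup (Fin n) ℂ) (hfeas : UnitaryFeasible U)
    (μ : Measure (Fin n → selfAdjoint (Matrix (Fin n) (Fin n) ℂ)))
    [μ.IsAddHaarMeasure] :
    μ {Q | (MM U (fun i => (Q i).1)).det = 0} = 0 := by
  obtain ⟨R, hR⟩ := exists_herm U hU hfeas
  have : BorelSpace (Matrix (Fin n) (Fin n) ℂ) :=
    inferInstanceAs (BorelSpace (Fin n → Fin n → ℂ))
  have : SecondCountableTopology (Matrix (Fin n) (Fin n) ℂ) :=
    inferInstanceAs (SecondCountableTopology (Fin n → Fin n → ℂ))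
  have : BorelSpace (selfAdjoint (Matrix (Fin n) (Fin n) ℂ)) :=
    Subtype.borelSpace _
  have : SecondCountableTopology (selfAdjoint (Matrix (Fin n) (Fin n) ℂ)) :=
    TopologicalSpace.Subtype.secondCountableTopology _
  have : FiniteDimensional ℝ (Matrix (Fin n) (Fin n) ℂ) :=
    inferInstanceAs (FiniteDimensional ℝ (Fin n → Fin n → ℂ))
  have : FiniteDimensional ℝ (selfAdjoint (Matrix (Fin n) (Fin n) ℂ)) :=
    inferInstanceAs (FiniteDimensional ℝ (selfAdjoint.submodule ℝ (Matrix (Fin n) (Fin n) ℂ)))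
  have : ContinuousSMul ℝ (selfAdjoint (Matrix (Fin n) (Fin n) ℂ)) := by
    refine ⟨Continuous.subtype_mk ?_ _⟩
    exact continuous_fst.smul (continuous_subtype_val.comp continuous_snd)
  refine null_of_lines' μ _ ?_ R ?_
  · refine isClosed_eq ?_ continuous_const
    refine Continuous.matrix_det ?_
    refine continuous_matrix fun p q => ?_
    unfold MM
    refine Continuous.matrix_elem ?_ _ _
    fun_prop
  · intro y
    have : ∀ t : ℝ, (fun i => ((y + t • R) i).1) = fun i => (y i).1 + (t : ℂ) • (R i).1 := by
      intro t
      ext i a b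
      simp [Complex.real_smul]
    obtain ⟨s₀, hs⟩ := pencil_exists (MM U (fun i => (y i).1)) _ hR
    refine (pencil_real_finite _ _ _ hs).subset ?_
    intro t ht
    simp only [Set.mem_ofPred_eq] at ht ⊢
    rwa [this, MM_add_smul] at ht

/-- Let `U` be a feasible unitary. For almost all (w.r.t. any Haar (Lebesgue)
measure on `H(n)^n`, the POVMs with `n+1` outcomes being identified with a subset of `H(n)^n`)
POVMs `P = (Q_1,…,Q_{n+1})`, the map `ρ ↦ (tr(U^j Q_i (U*)^j ρ))_{1≤i≤n+1, 0≤j≤n−1}` is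
injective on the set of quantum states. -/
theorem stmt2 {n : ℕ} (U : Matrix (Fin n) (Fin n) ℂ)
    (hU : U ∈ Matrix.unitaryGroup (Fin n) ℂ) (hfeas : UnitaryFeasible U)
    (μ : Measure (Fin n → selfAdjoint (Matrix (Fin n) (Fin n) ℂ)))
    [μ.IsAddHaarMeasure] :
    μ {Q | IsPOVM (povmExt Q) ∧
        ¬ Set.InjOn
          (fun ρ : Matrix (Fin n) (Fin n) ℂ => fun p : Fin (n + 1) × Fin n =>
            (U ^ (p.2 : ℕ) * povmExt Q p.1 * Uᴴ ^ (p.2 : ℕ) * ρ).trace.re)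
          {ρ | IsState ρ}} = 0 := by
  refine measure_mono_null ?_ (null_bad U hU hfeas μ)
  rintro Q ⟨-, hQ⟩
  by_contra hdet
  simp only [Set.mem_ofPred_eq] at hdet
  apply hQ
  intro ρ hρ ρ' hρ' heq
  rw [← sub_eq_zero]
  refine MM_inj U _ hdet _ fun i j => ?_
  have h1 := congrFun heq (i.castSucc, j)
  simp only [povmExt, Fin.snoc_castSucc] at h1
  set A := U ^ (j : ℕ) * (Q i : Matrix (Fin n) (Fin n) ℂ) * Uᴴ ^ (j : ℕ) with hA
  have hAh : Aᴴ = A := by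
    have hq : ((Q i : Matrix (Fin n) (Fin n) ℂ))ᴴ = Q i := (Q i).2
    rw [hA]
    simp only [Matrix.conjTranspose_mul, Matrix.conjTranspose_pow,
      Matrix.conjTranspose_conjTranspose, hq, Matrix.mul_assoc]
  have hX : (ρ - ρ')ᴴ = ρ - ρ' := by
    rw [Matrix.conjTranspose_sub, hρ.1.isHermitian.eq, hρ'.1.isHermitian.eq]
  apply Complex.ext
  · rw [Matrix.mul_sub, Matrix.trace_sub, Complex.sub_re, h1]
    simp
  · have : star (A * (ρ - ρ')).trace = (A * (ρ - ρ')).trace := by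
      rw [← Matrix.trace_conjTranspose, Matrix.conjTranspose_mul, hAh, hX, Matrix.trace_mul_comm]
    exact Complex.conj_eq_iff_im.1 this
end

section
/- Let U be a feasible n×n unitary matrix. Then for almost all POVMs P = (Q_1,…,Q_n) with n outcomes, the measurement scheme obtained by measuring P at the n+1 time steps j = 0,…,n of the evolution X ↦ U X U* is informationally complete; that is, the map sending a quantum state ρ to the vector (tr(U^j Q_i (U*)^j ρ)) indexed by 1 ≤ i ≤ n, 0 ≤ j ≤ n is injective on the set of all quantum states on ℂ^n. -/
open Matrix MeasureTheory
open scoped ComplexOrder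

lemma aux_finite {W F : Type*} [AddCommGroup W] [Module ℂ W] [FiniteDimensional ℂ W]
    [AddCommGroup F] [Module ℂ F] (M T : W →ₗ[ℂ] F) (hM : Function.Injective M) :
    {r : ℂ | ¬ Function.Injective (M + r • T)}.Finite := by
  obtain ⟨B, hB⟩ := LinearMap.exists_leftInverse_of_injective M (LinearMap.ker_eq_bot.2 hM)
  have hfin := Module.End.finite_hasEigenvalue (B ∘ₗ T)
  refine (hfin.preimage (f := fun r : ℂ => -r⁻¹) ?_).subset ?_
  · intro a _ b _ h
    simpa using h
  · intro r hr
    simp only [Set.mem_setOf_eq] at hr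
    rw [← LinearMap.ker_eq_bot, LinearMap.ker_eq_bot'] at hr
    push Not at hr
    obtain ⟨w, hw, hw0⟩ := hr
    have h1 : w + r • B (T w) = 0 := by
      have := congrArg B hw
      have h2 : B (M w) = w := LinearMap.congr_fun hB w
      simpa [h2] using this
    have hr0 : r ≠ 0 := by
      rintro rfl
      simp at h1
      exact hw0 h1
    refine Module.End.hasEigenvalue_of_hasEigenvector (x := w) ⟨?_, hw0⟩
    rw [Module.End.mem_eigenspace_iff]
    have h3 : r • B (T w) = -w := by
      rw [eq_neg_iff_add_eq_zero, add_comm]; exact h1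
    have : r⁻¹ • (r • B (T w)) = r⁻¹ • (-w) := by rw [h3]
    rw [smul_smul, inv_mul_cancel₀ hr0, one_smul] at this
    simp [this]

lemma aux_null {E W F : Type*} [NormedAddCommGroup E] [NormedSpace ℝ E] [FiniteDimensional ℝ E]
    [MeasurableSpace E] [BorelSpace E]
    [AddCommGroup W] [Module ℂ W] [FiniteDimensional ℂ W]
    [NormedAddCommGroup F] [NormedSpace ℂ F]
    (A : E →ₗ[ℝ] (W →ₗ[ℂ] F)) (v : E) (hv : Function.Injective (A v))
    (μ : Measure E) [μ.IsAddHaarMeasure] :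
    μ {x | ¬ Function.Injective (A x)} = 0 := by
  have : ProperSpace E := FiniteDimensional.proper_real E
  let b := Module.finBasis ℂ W
  have hiff : ∀ x, Function.Injective (A x) ↔ LinearIndependent ℂ (fun i => A x (b i)) := by
    intro x
    rw [← LinearMap.ker_eq_bot]
    constructor
    · intro h
      exact b.linearIndependent.map' (A x) h
    · intro h
      rw [LinearMap.ker_eq_bot']
      intro w hw
      rw [← b.sum_repr w] at hw
      simp only [map_sum, map_smul] at hw
      have := Fintype.linearIndependent_iff.1 h _ hw
      rw [← b.sum_repr w]
      simp [this]
  have hopen : IsOpen {x | Function.Injective (A x)} := by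
    simp only [hiff]
    let g : E →ₗ[ℝ] (Fin (Module.finrank ℂ W) → F) :=
      { toFun := fun x i => A x (b i)
        map_add' := by intro x y; ext i; simp
        map_smul' := by intro c y; ext i; simp }
    exact isOpen_setOf_linearIndependent.preimage g.continuous_of_finiteDimensional
  have := ae_mem_of_ae_add_linearMap_mem (LinearMap.toSpanSingleton ℝ E v) volume μ
    hopen.measurableSet ?_
  · exact this
  intro x
  have hf : {t : ℝ | ¬ Function.Injective (A (x + t • v))}.Finite := by
    have h1 := aux_finite (A v) (A x) hv
    have h2 : {t : ℝ | ((t⁻¹ : ℝ) : ℂ) ∈ {r : ℂ | ¬ Function.Injective (A v + r • A x)}}.Finite := by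
      refine h1.preimage (f := fun t : ℝ => ((t⁻¹ : ℝ) : ℂ)) ?_
      intro a _ b _ h
      simpa using h
    refine (h2.union (Set.finite_singleton 0)).subset ?_
    intro t ht
    by_cases h0 : t = 0
    · right; exact h0
    left
    intro hinj
    apply ht
    have : ∀ w, A (x + t • v) w = (t : ℂ) • (A v + ((t⁻¹ : ℝ) : ℂ) • A x) w := by
      intro w
      have h0' : (t : ℂ) ≠ 0 := by exact_mod_cast h0
      simp only [map_add, map_smul, LinearMap.add_apply, LinearMap.smul_apply, smul_add, smul_smul,
        Complex.ofReal_inv, mul_inv_cancel₀ h0', one_smul]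
      rw [add_comm, Complex.coe_smul]
    intro w w' hww
    rw [this, this] at hww
    exact hinj (smul_right_injective _ (by exact_mod_cast h0 : (t : ℂ) ≠ 0) hww)
  have := hf.measure_zero volume
  rw [ae_iff]
  simpa [LinearMap.toSpanSingleton_apply] using this

/-- the traceless matrices -/
noncomputable abbrev tl (n : ℕ) : Submodule ℂ (Matrix (Fin n) (Fin n) ℂ) :=
  LinearMap.ker (Matrix.traceLinearMap (Fin n) ℂ ℂ)

/-- the measurement map -/
noncomputable def measC {n : ℕ} (U : Matrix (Fin n) (Fin n) ℂ) :
    (Fin (n - 1) → Matrix (Fin n) (Fin n) ℂ) →ₗ[ℂ]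
      (tl n →ₗ[ℂ] (Fin (n - 1) × Fin (n + 1) → ℂ)) :=
  LinearMap.mk₂ ℂ (fun Q D p => (U ^ (p.2 : ℕ) * Q p.1 * Uᴴ ^ (p.2 : ℕ) * (D : Matrix (Fin n) (Fin n) ℂ)).trace)
    (by intros; ext p; simp [Matrix.mul_add, Matrix.add_mul])
    (by intros; ext p; simp)
    (by intros; ext p; simp [Matrix.mul_add])
    (by intros; ext p; simp)

lemma aux_exists {n : ℕ} (U : Matrix (Fin n) (Fin n) ℂ) (hU : U ∈ Matrix.unitaryGroup (Fin n) ℂ)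
    (hfeas : UnitaryFeasible U) :
    ∃ Q, Function.Injective (measC U Q) := by
  obtain ⟨V, lam, hV, rfl, hd⟩ := hfeas
  have hV1 : Vᴴ * V = 1 := (Matrix.mem_unitaryGroup_iff'.1 hV)
  have hV2 : V * Vᴴ = 1 := (Matrix.mem_unitaryGroup_iff.1 hV)
  have hpow : ∀ (L : Matrix (Fin n) (Fin n) ℂ) (j : ℕ), (V * L * Vᴴ) ^ j = V * L ^ j * Vᴴ := by
    intro L j
    induction j with
    | zero => simp [hV2]
    | succ j ih =>
      rw [pow_succ, ih, pow_succ]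
      calc V * L ^ j * Vᴴ * (V * L * Vᴴ) = V * L ^ j * (Vᴴ * V) * L * Vᴴ := by noncomm_ring
        _ = _ := by rw [hV1]; noncomm_ring
  have hcard : Fintype.card {p : Fin n × Fin n // p.1 ≠ p.2} = Fintype.card (Fin (n - 1) × Fin n) := by
    have h1 := Fintype.card_subtype_compl (fun p : Fin n × Fin n => p.1 = p.2)
    have h2 : Fintype.card {p : Fin n × Fin n // p.1 = p.2} = n := by
      rw [Fintype.card_congr (β := Fin n)
        ⟨fun p => p.1.1, fun k => ⟨(k, k), rfl⟩, fun ⟨⟨a, b⟩, h⟩ => by cases h; rfl, fun k => rfl⟩]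
      simp
    rw [h2] at h1
    simp only [ne_eq]
    rw [h1]
    simp [Nat.sub_mul]
  obtain e := Fintype.equivOfCardEq hcard
  let ι : Fin (n - 1) → Fin n := Fin.castLE (Nat.sub_le n 1)
  let C : Fin (n - 1) → Matrix (Fin n) (Fin n) ℂ := fun i =>
    Matrix.of fun k l => if h : k ≠ l then (if (e ⟨(k, l), h⟩).1 = i then 1 else 0)
      else if k = ι i then 1 else 0
  refine ⟨fun i => V * C i * Vᴴ, ?_⟩
  rw [← LinearMap.ker_eq_bot, LinearMap.ker_eq_bot']
  rintro ⟨D, hD⟩ h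
  have hDt : D.trace = 0 := by simpa using hD
  let D' := Vᴴ * D * V
  have hD't : D'.trace = 0 := by
    simp only [D']
    rw [Matrix.trace_mul_comm, ← Matrix.mul_assoc, hV2, Matrix.one_mul, hDt]
  have hDD' : D = V * D' * Vᴴ := by
    calc D = (V * Vᴴ) * D * (V * Vᴴ) := by rw [hV2]; simp
      _ = _ := by simp only [D']; noncomm_ring
  let w : Fin n × Fin n → ℂ := fun p => lam p.1 * starRingEnd ℂ (lam p.2)
  have hsum : ∀ (i : Fin (n - 1)) (j : Fin (n + 1)),
      ∑ k, ∑ l, C i k l * D' l k * w (k, l) ^ (j : ℕ) = 0 := by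
    intro i j
    have h1 := congrFun h (i, j)
    simp only [measC, LinearMap.mk₂_apply, Pi.zero_apply] at h1
    have h2 : (V * diagonal lam * Vᴴ)ᴴ = V * diagonal (star lam) * Vᴴ := by
      simp [Matrix.mul_assoc]
    rw [h2, hpow, hpow] at h1
    have h3 : V * diagonal lam ^ (j : ℕ) * Vᴴ * (V * C i * Vᴴ) *
        (V * diagonal (star lam) ^ (j : ℕ) * Vᴴ) * D =
        V * (diagonal lam ^ (j : ℕ) * ((Vᴴ * V) * C i * (Vᴴ * V)) *
          diagonal (star lam) ^ (j : ℕ) * (Vᴴ * D)) := by noncomm_ring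
    rw [h3, hV1, Matrix.trace_mul_comm, Matrix.one_mul, Matrix.mul_one, Matrix.mul_assoc,
      Matrix.diagonal_pow, Matrix.diagonal_pow] at h1
    change (_ * D').trace = 0 at h1
    rw [← h1, Matrix.trace]
    refine Finset.sum_congr rfl fun k _ => ?_
    rw [Matrix.diag_apply, Matrix.mul_apply]
    refine Finset.sum_congr rfl fun l _ => ?_
    simp only [w, Matrix.mul_diagonal, Matrix.diagonal_mul, mul_pow, Pi.pow_apply, Pi.star_apply,
      starRingEnd_apply]
    ring
  have hwd : ∀ k (j : ℕ), w (k, k) ^ j = 1 := by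
    intro k j
    have h2 := Matrix.mem_unitaryGroup_iff.1 hU
    rw [Matrix.star_eq_conjTranspose] at h2
    have h3 : diagonal lam * diagonal (star lam) = 1 := by
      calc diagonal lam * diagonal (star lam)
          = (Vᴴ * V) * diagonal lam * (Vᴴ * V) * diagonal (star lam) * (Vᴴ * V) := by
            rw [hV1]; simp
        _ = Vᴴ * ((V * diagonal lam * Vᴴ) * (V * diagonal lam * Vᴴ)ᴴ) * V := by
            have : (V * diagonal lam * Vᴴ)ᴴ = V * diagonal (star lam) * Vᴴ := by
              simp [Matrix.mul_assoc]
            rw [this]; noncomm_ring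
        _ = 1 := by rw [h2, Matrix.mul_one, hV1]
    have h4 := congrFun (congrFun h3 k) k
    rw [Matrix.diagonal_mul_diagonal] at h4
    simp only [Matrix.diagonal_apply_eq, Matrix.one_apply_eq] at h4
    have : w (k, k) = 1 := h4
    rw [this, one_pow]
  have hw1 : ∀ p : Fin n × Fin n, p.1 ≠ p.2 → w p ≠ 1 := by
    rintro ⟨k, l⟩ hkl hw
    simp only [w] at hw hkl
    have hw' := congrArg (starRingEnd ℂ) hw
    simp only [map_mul, Complex.conj_conj, map_one] at hw'
    have := hd k l l k hkl hkl.symm (by rw [hw', mul_comm, hw])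
    exact hkl this.1
  have hwinj : ∀ p q : Fin n × Fin n, p.1 ≠ p.2 → q.1 ≠ q.2 → w p = w q → p = q := by
    rintro ⟨k, l⟩ ⟨k', l'⟩ hp hq hw
    simp only [w] at hw hp hq
    have := hd l k l' k' hp.symm hq.symm (by rw [mul_comm, hw, mul_comm])
    rw [this.1, this.2]
  have hkey : ∀ i : Fin (n - 1), D' (ι i) (ι i) = 0 ∧
      ∀ m : Fin n, D' (e.symm (i, m)).1.2 (e.symm (i, m)).1.1 = 0 := by
    intro i
    let f : Fin (n + 1) → ℂ := Fin.cons 1 (fun m => w (e.symm (i, m)).1)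
    let v : Fin (n + 1) → ℂ := Fin.cons (D' (ι i) (ι i))
      (fun m => D' (e.symm (i, m)).1.2 (e.symm (i, m)).1.1)
    have hf : Function.Injective f := by
      refine Fin.cons_injective_iff.2 ⟨?_, ?_⟩
      · rintro ⟨m, hm⟩
        exact hw1 _ (e.symm (i, m)).2 hm
      · intro m m' hm
        have := hwinj _ _ (e.symm (i, m)).2 (e.symm (i, m')).2 hm
        have := e.symm.injective (Subtype.ext this)
        simpa using this
    have hv : v = 0 := by
      refine Matrix.eq_zero_of_forall_pow_sum_mul_pow_eq_zero hf fun j => ?_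
      rw [← hsum i j, Fin.sum_univ_succ]
      simp only [f, v, Fin.cons_zero, Fin.cons_succ, one_pow, mul_one]
      rw [← Fintype.sum_prod_type' (f := fun k l => C i k l * D' l k * w (k, l) ^ (j : ℕ))]
      rw [← Fintype.sum_subtype_add_sum_subtype (fun p : Fin n × Fin n => p.1 = p.2)]
      congr 1
      · rw [Fintype.sum_eq_single (⟨(ι i, ι i), rfl⟩ : {p : Fin n × Fin n // p.1 = p.2})]
        · have hw0 : w (ι i, ι i) ^ (j : ℕ) = 1 := hwd _ j
          simp [C, hw0]
        · rintro ⟨⟨a, b⟩, hab⟩ hne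
          simp only at hab
          subst hab
          have : a ≠ ι i := by
            rintro rfl
            exact hne rfl
          simp [C, this]
      · rw [← e.symm.sum_comp, Fintype.sum_prod_type]
        rw [Fintype.sum_eq_single i]
        · refine Finset.sum_congr rfl fun m _ => ?_
          have h0 := (e.symm (i, m)).2
          have h1 : C i (e.symm (i, m)).1.1 (e.symm (i, m)).1.2 = 1 := by
            simp [C, h0]
          rw [h1, one_mul]
        · intro i' hi'
          refine Finset.sum_eq_zero fun m _ => ?_
          have h0 := (e.symm (i', m)).2
          have h1 : C i (e.symm (i', m)).1.1 (e.symm (i', m)).1.2 = 0 := by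
            simp [C, h0, hi']
          rw [h1, zero_mul, zero_mul]
    constructor
    · exact congrFun hv 0
    · intro m
      exact congrFun hv m.succ
  have hoff : ∀ k l, k ≠ l → D' l k = 0 := by
    intro k l hkl
    have := (hkey (e ⟨(k, l), hkl⟩).1).2 (e ⟨(k, l), hkl⟩).2
    simpa using this
  have hdiag : ∀ k, D' k k = 0 := by
    have hlt : ∀ k : Fin n, (k : ℕ) < n - 1 → D' k k = 0 := by
      intro k hk
      exact (hkey ⟨k, hk⟩).1
    intro k
    by_cases hk : (k : ℕ) < n - 1
    · exact hlt k hk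
    · have hs : D'.trace = D' k k := by
        refine Fintype.sum_eq_single (f := fun l => D' l l) k (fun l hl => ?_)
        refine hlt l ?_
        have : (l : ℕ) ≠ k := fun h => hl (Fin.ext h)
        omega
      rw [← hs, hD't]
  have : D' = 0 := by
    ext l k
    by_cases hkl : k = l
    · subst hkl; exact hdiag k
    · exact hoff k l hkl
  ext1
  change D = 0
  rw [hDD', this]; simp

/-- Let `U` be a feasible unitary. For almost all (w.r.t. any Haar (Lebesgue)
measure on `H(n)^{n-1}`, the POVMs with `n` outcomes being identified with a subset of
`H(n)^{n-1}`) POVMs `P = (Q_1,…,Q_n)`, the map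
`ρ ↦ (tr(U^j Q_i (U*)^j ρ))_{1≤i≤n, 0≤j≤n}` is injective on the set of quantum states. -/
theorem stmt3 {n : ℕ} (U : Matrix (Fin n) (Fin n) ℂ)
    (hU : U ∈ Matrix.unitaryGroup (Fin n) ℂ) (hfeas : UnitaryFeasible U)
    (μ : Measure (Fin (n - 1) → selfAdjoint (Matrix (Fin n) (Fin n) ℂ)))
    [μ.IsAddHaarMeasure] :
    μ {Q | IsPOVM (povmExt Q) ∧
        ¬ Set.InjOn
          (fun ρ : Matrix (Fin n) (Fin n) ℂ => fun p : Fin (n - 1 + 1) × Fin (n + 1) =>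
            (U ^ (p.2 : ℕ) * povmExt Q p.1 * Uᴴ ^ (p.2 : ℕ) * ρ).trace.re)
          {ρ | IsState ρ}} = 0 := by
  have hμ : μ.IsAddHaarMeasure := inferInstance
  obtain ⟨Q0, hQ0⟩ := aux_exists U hU hfeas
  let X : Fin (n - 1) → selfAdjoint (Matrix (Fin n) (Fin n) ℂ) := fun i => realPart (Q0 i)
  let Y : Fin (n - 1) → selfAdjoint (Matrix (Fin n) (Fin n) ℂ) := fun i => imaginaryPart (Q0 i)
  let ic : (Fin (n - 1) → selfAdjoint (Matrix (Fin n) (Fin n) ℂ)) →ₗ[ℝ]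
      (Fin (n - 1) → Matrix (Fin n) (Fin n) ℂ) :=
    { toFun := fun Q i => Q i
      map_add' := by intros; rfl
      map_smul' := by intros; rfl }
  let A := ((measC U).restrictScalars ℝ) ∘ₗ ic
  obtain ⟨v, hv⟩ : ∃ v, Function.Injective (A v) := by
    have h1 := aux_finite (measC U Q0) (measC U (ic Y)) hQ0
    have h2 := h1.preimage (f := fun s : ℝ => (s : ℂ) - Complex.I) (by
      intro a _ b _ h
      simpa using h)
    obtain ⟨s, hs⟩ := h2.infinite_compl.nonempty
    simp only [Set.mem_compl_iff, Set.mem_preimage, Set.mem_setOf_eq, not_not] at hs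
    refine ⟨X + s • Y, ?_⟩
    convert hs using 2
    simp only [A, LinearMap.comp_apply, LinearMap.restrictScalars_apply]
    rw [← map_smul, ← map_add]
    congr 1
    ext1 i
    have := realPart_add_I_smul_imaginaryPart (Q0 i)
    change (realPart (Q0 i) : Matrix (Fin n) (Fin n) ℂ) + (s : ℝ) • (imaginaryPart (Q0 i) : Matrix (Fin n) (Fin n) ℂ) = Q0 i + ((s : ℂ) - Complex.I) • (imaginaryPart (Q0 i) : Matrix (Fin n) (Fin n) ℂ)
    nth_rw 3 [← this]
    rw [sub_smul, Complex.coe_smul]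
    abel
  have : BorelSpace (Matrix (Fin n) (Fin n) ℂ) :=
    inferInstanceAs (BorelSpace (Fin n → Fin n → ℂ))
  have : SecondCountableTopology (Matrix (Fin n) (Fin n) ℂ) :=
    inferInstanceAs (SecondCountableTopology (Fin n → Fin n → ℂ))
  have : BorelSpace (selfAdjoint (Matrix (Fin n) (Fin n) ℂ)) := Subtype.borelSpace _
  have : SecondCountableTopology (selfAdjoint (Matrix (Fin n) (Fin n) ℂ)) :=
    TopologicalSpace.Subtype.secondCountableTopology _
  have hbor : BorelSpace (Fin (n - 1) → selfAdjoint (Matrix (Fin n) (Fin n) ℂ)) := Pi.borelSpace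
  let _ : NormedAddCommGroup (Matrix (Fin n) (Fin n) ℂ) := Matrix.normedAddCommGroup
  let _ : NormedSpace ℝ (Matrix (Fin n) (Fin n) ℂ) := Matrix.normedSpace
  let _ : NormedAddCommGroup (selfAdjoint (Matrix (Fin n) (Fin n) ℂ)) := AddSubgroup.normedAddCommGroup
  let _ : NormedSpace ℝ (selfAdjoint (Matrix (Fin n) (Fin n) ℂ)) :=
    { norm_smul_le := fun c x => norm_smul_le c (x : Matrix (Fin n) (Fin n) ℂ) }
  have : FiniteDimensional ℝ (selfAdjoint (Matrix (Fin n) (Fin n) ℂ)) :=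
    FiniteDimensional.of_injective (selfAdjoint.submodule ℝ (Matrix (Fin n) (Fin n) ℂ)).subtype Subtype.val_injective
  have hnull := @aux_null _ _ _ _ _ _ _ hbor _ _ _ _ _ A v hv μ hμ
  refine measure_mono_null ?_ hnull
  rintro Q ⟨-, hQ⟩ hinj
  apply hQ
  intro ρ hρ σ hσ hρσ
  have htl : ρ - σ ∈ tl n := by
    simp [hρ.2, hσ.2]
  have : A Q ⟨ρ - σ, htl⟩ = 0 := by
    ext ⟨i, j⟩
    change (U ^ (j : ℕ) * (Q i : Matrix (Fin n) (Fin n) ℂ) * Uᴴ ^ (j : ℕ) * (ρ - σ)).trace = 0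
    have h1 := congrFun hρσ (i.castSucc, j)
    simp only [povmExt, Fin.snoc_castSucc] at h1
    have hQi : (Q i : Matrix (Fin n) (Fin n) ℂ)ᴴ = Q i := (Q i).2
    have hρh : ρᴴ = ρ := hρ.1.1
    have hσh : σᴴ = σ := hσ.1.1
    set M := U ^ (j : ℕ) * (Q i : Matrix (Fin n) (Fin n) ℂ) * Uᴴ ^ (j : ℕ) with hM
    have hMh : Mᴴ = M := by
      simp [hM, hQi, Matrix.conjTranspose_pow, Matrix.mul_assoc]
    apply Complex.ext
    · rw [Matrix.mul_sub, Matrix.trace_sub, Complex.sub_re, h1]; simp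
    · have : star (M * (ρ - σ)).trace = (M * (ρ - σ)).trace := by
        rw [← Matrix.trace_conjTranspose, Matrix.conjTranspose_mul, hMh,
          Matrix.conjTranspose_sub, hρh, hσh, Matrix.trace_mul_comm]
      exact Complex.conj_eq_iff_im.1 this
  have := hinj (this.trans (map_zero _).symm)
  exact sub_eq_zero.1 (congrArg Subtype.val this)
end

section
/- Let U be a feasible n×n unitary matrix, let m ≥ n and let l ∈ ℕ satisfy l(m−1) ≥ n²−1. Then for almost all POVMs P = (Q_1,…,Q_m) with m outcomes, the measurement scheme T_U^l(P) is stably informationally complete: its probability map h(ρ) = (tr(U^j Q_i (U*)^j ρ))_{1≤i≤m, 0≤j≤l−1} is injective on the set of all quantum states, and moreover there is ε > 0 such that every measurement scheme of the same format whose probability map h' satisfies ‖h−h'‖ < ε is also injective on the set of all quantum states. -/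
open Matrix MeasureTheory
open scoped ComplexOrder

/-- The Frobenius (Hilbert-Schmidt) norm of a matrix. -/
noncomputable def frobNorm {n : ℕ} (X : Matrix (Fin n) (Fin n) ℂ) : ℝ :=
  Real.sqrt (∑ i, ∑ j, Complex.normSq (X i j))


lemma pencil_finite_s4 {K V W : Type*} [Field K] [AddCommGroup V] [Module K V] [FiniteDimensional K V]
    [AddCommGroup W] [Module K W] (f g : V →ₗ[K] W) (t0 : K)
    (h : Function.Injective (f + t0 • g)) :
    {t : K | ¬ Function.Injective (f + t • g)}.Finite := by
  obtain ⟨r, hr⟩ := LinearMap.exists_leftInverse_of_injective _ (LinearMap.ker_eq_bot.2 h)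
  have hfin : {e : K | Module.End.HasEigenvalue (r ∘ₗ g) e}.Finite :=
    Module.End.finite_hasEigenvalue _
  refine (hfin.preimage (f := fun t : K => -(t - t0)⁻¹) ?_).subset ?_
  · intro a _ b _ hab
    simpa using hab
  · intro t ht
    simp only [Set.mem_ofPred_eq] at ht
    rw [← LinearMap.ker_eq_bot, Submodule.eq_bot_iff] at ht
    push Not at ht
    obtain ⟨x, hx, hx0⟩ := ht
    have hne : t - t0 ≠ 0 := by
      intro h0
      rw [sub_eq_zero.1 h0, LinearMap.ker_eq_bot.2 h] at hx
      exact hx0 (by simpa using hx)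
    have h1 : f x + t • g x = 0 := by simpa using hx
    have h2 : r (f x + t0 • g x) = x := by simpa using LinearMap.congr_fun hr x
    have h3 : f x = - (t • g x) := eq_neg_of_add_eq_zero_left h1
    have h4 : (t - t0) • r (g x) = - x := by
      rw [h3] at h2
      conv_rhs => rw [← h2]
      simp only [map_add, map_neg, map_smul]
      module
    simp only [Set.mem_preimage, Set.mem_ofPred_eq]
    refine Module.End.hasEigenvalue_of_hasEigenvector (x := x)
      ⟨Module.End.mem_eigenspace_iff.2 ?_, hx0⟩
    simp only [LinearMap.comp_apply]
    rw [neg_smul, ← smul_neg, ← h4, smul_smul, inv_mul_cancel₀ hne, one_smul]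

lemma ae_injective {E V W : Type*} [NormedAddCommGroup E] [NormedSpace ℝ E]
    [FiniteDimensional ℝ E] [MeasurableSpace E] [BorelSpace E] (μ : Measure E) [μ.IsAddHaarMeasure]
    [NormedAddCommGroup V] [NormedSpace ℂ V] [FiniteDimensional ℂ V]
    [NormedAddCommGroup W] [NormedSpace ℂ W] [FiniteDimensional ℂ W]
    (c : V →ₗ[ℂ] W) (G : E →ₗ[ℝ] (V →ₗ[ℂ] W))
    (hs : ∀ (x : E) (s : ℝ), s ≠ 0 → Function.Injective (c + G (s • x)) →
      Function.Injective (c + G x))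
    (x0 : E) (h0 : Function.Injective (c + G x0)) :
    ∀ᵐ x ∂μ, Function.Injective (c + G x) := by
  have key : ∀ a b : E, (∃ t : ℝ, Function.Injective (c + G (a + t • b))) →
      {t : ℝ | ¬ Function.Injective (c + G (a + t • b))}.Finite := by
    rintro a b ⟨t0, ht0⟩
    have e : ∀ t : ℝ, c + G (a + t • b) = (c + G a) + (t : ℂ) • G b := by
      intro t
      ext v
      simp [add_assoc]
    simp only [e] at ht0 ⊢
    exact (pencil_finite_s4 _ _ _ ht0).preimage (f := fun t : ℝ => (t : ℂ))
      (Complex.ofReal_injective.injOn)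
  have hopen : IsOpen {x : E | Function.Injective (c + G x)} := by
    let Φ : E →ₗ[ℝ] (V →L[ℂ] W) :=
      ((LinearMap.toContinuousLinearMap (𝕜 := ℂ) (E := V) (F' := W)).toLinearMap.restrictScalars ℝ)
        ∘ₗ G
    have hΦ : Continuous (fun x => LinearMap.toContinuousLinearMap c + Φ x) :=
      continuous_const.add Φ.continuous_of_finiteDimensional
    exact (ContinuousLinearMap.isOpen_injective (𝕜 := ℂ) (E := V) (F := W)).preimage hΦ
  have : ProperSpace E := FiniteDimensional.proper ℝ E
  have : LocallyCompactSpace E := inferInstance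
  refine ae_mem_of_ae_add_linearMap_mem (𝕜 := ℝ) (LinearMap.toSpanSingleton ℝ E x0) volume μ
    hopen.measurableSet ?_
  intro y
  have hex : ∃ t : ℝ, Function.Injective (c + G (y + t • x0)) := by
    have h1 := key x0 y ⟨0, by simpa using h0⟩
    obtain ⟨s, hs1⟩ := ((h1.union (Set.finite_singleton 0)).infinite_compl).nonempty
    simp only [Set.mem_compl_iff, Set.mem_union, Set.mem_ofPred_eq, Set.mem_singleton_iff,
      not_or, not_not] at hs1
    refine ⟨s⁻¹, hs _ s hs1.2 ?_⟩
    rw [smul_add, smul_smul, mul_inv_cancel₀ hs1.2, one_smul, add_comm (s • y) x0]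
    exact hs1.1
  have hf := key y x0 hex
  rw [ae_iff]
  exact hf.measure_zero _

lemma ae_injective' {E V W : Type*} [AddCommGroup E] [Module ℝ E] [TopologicalSpace E]
    [IsTopologicalAddGroup E] [ContinuousSMul ℝ E] [T2Space E]
    [FiniteDimensional ℝ E] [MeasurableSpace E] [BorelSpace E] (μ : Measure E) [μ.IsAddHaarMeasure]
    [AddCommGroup V] [Module ℂ V] [FiniteDimensional ℂ V]
    [NormedAddCommGroup W] [NormedSpace ℂ W] [FiniteDimensional ℂ W]
    (c : V →ₗ[ℂ] W) (G : E →ₗ[ℝ] (V →ₗ[ℂ] W))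
    (hs : ∀ (x : E) (s : ℝ), s ≠ 0 → Function.Injective (c + G (s • x)) →
      Function.Injective (c + G x))
    (x0 : E) (h0 : Function.Injective (c + G x0)) :
    ∀ᵐ x ∂μ, Function.Injective (c + G x) := by
  let e : E ≃L[ℝ] (Fin (Module.finrank ℝ E) → ℝ) :=
    (Module.finBasis ℝ E).equivFun.toContinuousLinearEquiv
  let v : V ≃ₗ[ℂ] (Fin (Module.finrank ℂ V) → ℂ) := (Module.finBasis ℂ V).equivFun
  let ν := μ.map e
  have hν : ν.IsAddHaarMeasure := e.isAddHaarMeasure_map μ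
  let G' : (Fin (Module.finrank ℝ E) → ℝ) →ₗ[ℝ] ((Fin (Module.finrank ℂ V) → ℂ) →ₗ[ℂ] W) :=
    { toFun := fun y => (G (e.symm y)) ∘ₗ v.symm.toLinearMap
      map_add' := by intro a b; ext; simp
      map_smul' := by intro a b; ext; simp }
  have hiff : ∀ x : E, Function.Injective (c ∘ₗ v.symm.toLinearMap + G' (e x)) ↔
      Function.Injective (c + G x) := by
    intro x
    have : c ∘ₗ v.symm.toLinearMap + G' (e x) = (c + G x) ∘ₗ v.symm.toLinearMap := by
      ext; simp [G']
    rw [this, LinearMap.coe_comp]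
    exact Function.Injective.of_comp_iff' _ v.symm.bijective
  have main := ae_injective ν (c ∘ₗ v.symm.toLinearMap) G' (by
    intro y s hs0 h
    obtain ⟨x, rfl⟩ := e.surjective y
    rw [← map_smul e, hiff] at h
    rw [hiff]
    exact hs x s hs0 h) (e x0) ((hiff x0).2 h0)
  have h2 := ae_of_ae_map (e.continuous.measurable.aemeasurable) main
  filter_upwards [h2] with x hx
  exact (hiff x).1 hx

lemma exists_assign {n k l : ℕ} (hn : 0 < n) (hk : n ≤ k) (hl : (n + 1) ^ 2 - 1 ≤ l * k) (hl0 : 0 < l) :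
    ∃ φ : Fin (n + 1) × Fin (n + 1) → Fin k × Fin l,
      Set.InjOn φ {p | p ≠ (Fin.last n, Fin.last n)} ∧
      ∀ a b : Fin (n + 1), a ≠ Fin.last n → b ≠ Fin.last n → (φ (a, a)).1 = (φ (b, b)).1 →
        a = b := by
  classical
  have hk0 : 0 < k := by omega
  let E := {p : Fin (n + 1) × Fin (n + 1) // p ≠ (Fin.last n, Fin.last n)}
  let f : E → Fin k × Fin l := fun p =>
    (if h : (p.1.1 : ℕ) < k then ⟨p.1.1, h⟩ else ⟨0, hk0⟩, ⟨0, hl0⟩)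
  let s : Finset E := Finset.univ.filter (fun p => p.1.1 = p.1.2)
  have hE : Fintype.card E = (n + 1) ^ 2 - 1 := by
    simp [E, Fintype.card_subtype_compl, sq]
  have hlt : ∀ a : Fin (n + 1), a ≠ Fin.last n → (a : ℕ) < k := fun a ha => by
    have := Fin.val_lt_last ha
    omega
  have hmem : ∀ p ∈ s, p.1.1 ≠ Fin.last n := by
    intro p hp h
    have h2 : p.1.1 = p.1.2 := by simpa [s] using hp
    exact p.2 (Prod.ext h (h2 ▸ h))
  have hinj : Set.InjOn f s := by
    intro p hp q hq hpq
    have h1 := hlt _ (hmem p hp)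
    have h2 := hlt _ (hmem q hq)
    have hp' : p.1.1 = p.1.2 := by simpa [s] using hp
    have hq' : q.1.1 = q.1.2 := by simpa [s] using hq
    have : p.1.1 = q.1.1 := by
      simp only [f, h1, h2, dif_pos, Prod.mk.injEq, Fin.mk.injEq, and_true] at hpq
      exact Fin.ext hpq
    exact Subtype.ext (Prod.ext this (by rw [← hp', ← hq', this]))
  obtain ⟨t, hst, ht⟩ := Finset.exists_superset_card_eq (s := s.image f) (n := Fintype.card E)
    (by rw [Finset.card_image_of_injOn hinj]; exact Finset.card_le_univ _)
    (by rw [hE]; simpa [mul_comm] using hl)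
  obtain ⟨g, hg⟩ := Finset.exists_equiv_extend_of_card_eq ht.symm hst hinj
  refine ⟨fun p => if h : p ≠ (Fin.last n, Fin.last n) then (g ⟨p, h⟩ : Fin k × Fin l)
    else (⟨0, hk0⟩, ⟨0, hl0⟩), ?_, ?_⟩
  · intro p hp q hq hpq
    simp only [Set.mem_ofPred_eq] at hp hq
    simp only [hp, hq, dif_pos, ne_eq, not_false_eq_true] at hpq
    have := g.injective (Subtype.ext hpq)
    exact congrArg Subtype.val this
  · intro a b ha hb hab
    have ha' : (a, a) ≠ (Fin.last n, Fin.last n) := fun h => ha (congrArg Prod.fst h)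
    have hb' : (b, b) ≠ (Fin.last n, Fin.last n) := fun h => hb (congrArg Prod.fst h)
    have e1 := hg ⟨(a, a), ha'⟩ (by simp [s])
    have e2 := hg ⟨(b, b), hb'⟩ (by simp [s])
    simp only [ha', hb', dif_pos, ne_eq, not_false_eq_true, e1, e2, f, hlt a ha, hlt b hb,
      Fin.mk.injEq] at hab
    exact Fin.ext hab

lemma vander {ι : Type*} (T : Finset ι) (l : ℕ) (hT : T.card ≤ l) (w y : ι → ℂ)
    (hw : Set.InjOn w T) (h : ∀ j < l, ∑ e ∈ T, w e ^ j * y e = 0) : ∀ e ∈ T, y e = 0 := by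
  classical
  intro e he
  have hp : ∀ p : Polynomial ℂ, p.natDegree < l → ∑ e ∈ T, p.eval (w e) * y e = 0 := by
    intro p hp
    simp_rw [Polynomial.eval_eq_sum_range' hp, Finset.sum_mul]
    rw [Finset.sum_comm]
    refine Finset.sum_eq_zero fun j hj => ?_
    simp_rw [mul_assoc]
    rw [← Finset.mul_sum, h j (Finset.mem_range.1 hj), mul_zero]
  have h1 := hp (∏ e' ∈ T.erase e, (Polynomial.X - Polynomial.C (w e'))) (by
    rw [Polynomial.natDegree_prod_of_monic _ _ (fun i _ => Polynomial.monic_X_sub_C _)]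
    simp only [Polynomial.natDegree_X_sub_C, Finset.sum_const, smul_eq_mul, mul_one]
    rw [Finset.card_erase_of_mem he]
    have := Finset.card_pos.2 ⟨e, he⟩
    omega)
  rw [Finset.sum_eq_single_of_mem e he] at h1
  · rcases mul_eq_zero.1 h1 with h2 | h2
    · exfalso
      rw [Polynomial.eval_prod, Finset.prod_eq_zero_iff] at h2
      obtain ⟨a, ha, h3⟩ := h2
      simp only [Polynomial.eval_sub, Polynomial.eval_X, Polynomial.eval_C, sub_eq_zero] at h3
      rw [Finset.mem_erase] at ha
      exact ha.1 (hw ha.2 he h3.symm)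
    · exact h2
  · intro b hb hbe
    rw [Polynomial.eval_prod, Finset.prod_eq_zero (Finset.mem_erase.2 ⟨hbe, hb⟩), zero_mul]
    simp

lemma exists_complex {n k l : ℕ} (hn : 0 < n) (hk : n ≤ k) (hl : (n + 1) ^ 2 - 1 ≤ l * k)
    (hl0 : 0 < l) (U : Matrix (Fin (n + 1)) (Fin (n + 1)) ℂ)
    (hU : U ∈ Matrix.unitaryGroup (Fin (n + 1)) ℂ) (hfeas : UnitaryFeasible U) :
    ∃ Q : Fin k → Matrix (Fin (n + 1)) (Fin (n + 1)) ℂ,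
      ∀ X : Matrix (Fin (n + 1)) (Fin (n + 1)) ℂ, X.trace = 0 →
        (∀ i : Fin k, ∀ j : Fin l, (U ^ (j : ℕ) * Q i * Uᴴ ^ (j : ℕ) * X).trace = 0) → X = 0 := by
  classical
  obtain ⟨V, lam, hV, rfl, hd⟩ := hfeas
  obtain ⟨φ, hφ, hφd⟩ := exists_assign hn hk hl hl0
  have hV1 : Vᴴ * V = 1 := Matrix.mem_unitaryGroup_iff'.1 hV
  have hV2 : V * Vᴴ = 1 := Matrix.mem_unitaryGroup_iff.1 hV
  -- moduli
  have hlam : ∀ a, lam a * starRingEnd ℂ (lam a) = 1 := by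
    intro a
    have h1 := Matrix.mem_unitaryGroup_iff.1 hU
    have h2 : Matrix.diagonal lam * (Matrix.diagonal lam)ᴴ = 1 := by
      calc Matrix.diagonal lam * (Matrix.diagonal lam)ᴴ
          = (Vᴴ * V) * Matrix.diagonal lam * (Vᴴ * V) * (Matrix.diagonal lam)ᴴ * (Vᴴ * V) := by
            simp [hV1]
        _ = Vᴴ * ((V * Matrix.diagonal lam * Vᴴ) * star (V * Matrix.diagonal lam * Vᴴ)) * V := by
            simp only [Matrix.star_eq_conjTranspose, Matrix.conjTranspose_mul,
              Matrix.conjTranspose_conjTranspose, Matrix.mul_assoc]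
        _ = 1 := by rw [h1, Matrix.mul_one, hV1]
    have h3 := congrFun (congrFun h2 a) a
    simpa [Matrix.diagonal_conjTranspose, Matrix.diagonal_mul_diagonal] using h3
  have hne1 : ∀ a b, a ≠ b → lam a * starRingEnd ℂ (lam b) ≠ 1 := by
    intro a b hab h
    have h2 : starRingEnd ℂ (lam a) * lam b = 1 := by
      have := congrArg (starRingEnd ℂ) h
      simpa using this
    exact hab (hd a b b a hab hab.symm (by rw [h2, mul_comm, h])).1
  let D : Fin k → Matrix (Fin (n + 1)) (Fin (n + 1)) ℂ := fun i a b =>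
    if (a, b) ≠ (Fin.last n, Fin.last n) ∧ (φ (a, b)).1 = i then 1 else 0
  have hpow : ∀ j : ℕ, (V * Matrix.diagonal lam * Vᴴ) ^ j = V * Matrix.diagonal (lam ^ j) * Vᴴ := by
    intro j
    induction j with
    | zero => simp [hV2]
    | succ j ih =>
      rw [pow_succ, ih]
      calc _ = V * Matrix.diagonal (lam ^ j) * (Vᴴ * V) * Matrix.diagonal lam * Vᴴ := by
            simp only [Matrix.mul_assoc]
        _ = V * (Matrix.diagonal (lam ^ j) * Matrix.diagonal lam) * Vᴴ := by
            rw [hV1, Matrix.mul_one]; simp only [Matrix.mul_assoc]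
        _ = _ := by
            rw [Matrix.diagonal_mul_diagonal]; rfl
  refine ⟨fun i => V * D i * Vᴴ, fun X hX h => ?_⟩
  set Y := Vᴴ * X * V with hY
  have htr : ∀ i : Fin k, ∀ j : Fin l,
      ∑ p : Fin (n + 1) × Fin (n + 1),
        (lam p.1 * starRingEnd ℂ (lam p.2)) ^ (j : ℕ) * (D i p.1 p.2 * Y p.2 p.1) = 0 := by
    intro i j
    have h1 := h i j
    have h2 : (V * Matrix.diagonal lam * Vᴴ)ᴴ ^ (j : ℕ)
        = V * (Matrix.diagonal (lam ^ (j : ℕ)))ᴴ * Vᴴ := by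
      rw [← Matrix.conjTranspose_pow, hpow]
      simp only [Matrix.conjTranspose_mul, Matrix.conjTranspose_conjTranspose, Matrix.mul_assoc]
    rw [h2, hpow] at h1
    have h3 : V * Matrix.diagonal (lam ^ (j : ℕ)) * Vᴴ * (V * D i * Vᴴ) *
        (V * (Matrix.diagonal (lam ^ (j : ℕ)))ᴴ * Vᴴ) * X
        = V * (Matrix.diagonal (lam ^ (j : ℕ)) * D i * (Matrix.diagonal (lam ^ (j : ℕ)))ᴴ *
          (Vᴴ * X)) := by
      calc _ = V * Matrix.diagonal (lam ^ (j : ℕ)) * (Vᴴ * V) * D i * (Vᴴ * V) *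
            (Matrix.diagonal (lam ^ (j : ℕ)))ᴴ * Vᴴ * X := by simp only [Matrix.mul_assoc]
        _ = _ := by rw [hV1]; simp only [Matrix.mul_assoc, Matrix.mul_one, Matrix.one_mul]
    rw [h3, Matrix.trace_mul_comm, Matrix.mul_assoc, ← hY] at h1
    rw [← h1, Matrix.trace, Fintype.sum_prod_type]
    refine Finset.sum_congr rfl fun a _ => ?_
    rw [Matrix.diag_apply, Matrix.mul_apply]
    refine Finset.sum_congr rfl fun b _ => ?_
    rw [Matrix.diagonal_conjTranspose, Matrix.mul_diagonal, Matrix.diagonal_mul]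
    simp [mul_pow]
    ring
  have hYz : ∀ a b, (a, b) ≠ (Fin.last n, Fin.last n) → Y b a = 0 := by
    intro a b hab
    set i := (φ (a, b)).1 with hi
    let T : Finset (Fin (n + 1) × Fin (n + 1)) :=
      Finset.univ.filter fun p => p ≠ (Fin.last n, Fin.last n) ∧ (φ p).1 = i
    have hTm : ∀ p, p ∈ T ↔ p ≠ (Fin.last n, Fin.last n) ∧ (φ p).1 = i := by
      intro p; simp [T]
    refine vander T l ?_ (fun p => lam p.1 * starRingEnd ℂ (lam p.2)) (fun p => Y p.2 p.1)
      ?_ ?_ (a, b) ((hTm _).2 ⟨hab, hi.symm⟩)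
    · have := Finset.card_le_card_of_injOn (s := T) (t := (Finset.univ : Finset (Fin l)))
        (fun p => (φ p).2) (by simp) (by
          intro p hp q hq hpq
          have hp' := (hTm p).1 hp
          have hq' := (hTm q).1 hq
          exact hφ hp'.1 hq'.1 (Prod.ext (hp'.2.trans hq'.2.symm) hpq))
      simpa using this
    · rintro ⟨a, b⟩ hp ⟨c, d⟩ hq hpq
      have hp' := (hTm _).1 hp
      have hq' := (hTm _).1 hq
      simp only at hpq
      by_cases h1 : a = b
      · subst h1
        rw [hlam] at hpq
        by_cases h2 : c = d
        · subst h2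
          have : a = c := hφd a c (fun h => hp'.1 (by rw [h])) (fun h => hq'.1 (by rw [h]))
            (hp'.2.trans hq'.2.symm)
          rw [this]
        · exact absurd hpq.symm (hne1 _ _ h2)
      · by_cases h2 : c = d
        · subst h2
          rw [hlam] at hpq
          exact absurd hpq (hne1 _ _ h1)
        · have := hd b a d c (Ne.symm h1) (Ne.symm h2) (by rw [mul_comm, hpq, mul_comm])
          rw [this.1, this.2]
    · intro j hj
      rw [← htr i ⟨j, hj⟩, Finset.sum_filter]
      refine Finset.sum_congr rfl fun p _ => ?_
      by_cases hp : p ≠ (Fin.last n, Fin.last n) ∧ (φ p).1 = i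
      · simp only [hp, D]; simp
      · simp only [hp, D]; simp
  have hYtr : Y.trace = 0 := by
    rw [hY, Matrix.trace_mul_comm, ← Matrix.mul_assoc, hV2, Matrix.one_mul, hX]
  have hY0 : Y = 0 := by
    ext b a
    by_cases hab : (a, b) ≠ (Fin.last n, Fin.last n)
    · exact hYz a b hab
    · push Not at hab
      obtain ⟨rfl, rfl⟩ := Prod.mk.inj hab
      rw [Matrix.trace, Finset.sum_eq_single_of_mem (Fin.last n) (Finset.mem_univ _)] at hYtr
      · exact hYtr
      · intro c _ hc
        exact hYz c c (fun h => hc (congrArg Prod.fst h))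
  calc X = (V * Vᴴ) * X * (V * Vᴴ) := by rw [hV2]; simp
    _ = V * Y * Vᴴ := by rw [hY]; simp only [Matrix.mul_assoc]
    _ = 0 := by rw [hY0]; simp

/-- The complex bilinear pairing of tuples of effects with matrices. -/
noncomputable def pairMap {n k l : ℕ} (U : Matrix (Fin n) (Fin n) ℂ) :
    (Fin k → Matrix (Fin n) (Fin n) ℂ) →ₗ[ℂ] Matrix (Fin n) (Fin n) ℂ →ₗ[ℂ]
      (ℂ × (Fin k × Fin l → ℂ)) :=
  LinearMap.mk₂ ℂ
    (fun Q X => (0, fun p => (U ^ (p.2 : ℕ) * Q p.1 * Uᴴ ^ (p.2 : ℕ) * X).trace))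
    (by intro Q Q' X; ext <;> simp [Matrix.mul_add, Matrix.add_mul])
    (by intro c Q X; ext <;> simp)
    (by intro Q X X'; ext <;> simp [Matrix.mul_add])
    (by intro c Q X; ext <;> simp)

/-- The trace in the first coordinate. -/
noncomputable def trMap {n k l : ℕ} : Matrix (Fin n) (Fin n) ℂ →ₗ[ℂ]
      (ℂ × (Fin k × Fin l → ℂ)) :=
  LinearMap.inl ℂ ℂ (Fin k × Fin l → ℂ) ∘ₗ Matrix.traceLinearMap (Fin n) ℂ ℂ

lemma good_iff {n k l : ℕ} (U : Matrix (Fin n) (Fin n) ℂ)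
    (Q : Fin k → Matrix (Fin n) (Fin n) ℂ) :
    Function.Injective (trMap (n := n) (k := k) (l := l) + pairMap (l := l) U Q) ↔
      ∀ X : Matrix (Fin n) (Fin n) ℂ, X.trace = 0 →
        (∀ i : Fin k, ∀ j : Fin l, (U ^ (j : ℕ) * Q i * Uᴴ ^ (j : ℕ) * X).trace = 0) → X = 0 := by
  rw [← LinearMap.ker_eq_bot, Submodule.eq_bot_iff]
  refine forall_congr' fun X => ?_
  have : X ∈ LinearMap.ker (trMap (n := n) (k := k) (l := l) + pairMap (l := l) U Q) ↔ X.trace = 0 ∧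
      (∀ i : Fin k, ∀ j : Fin l, (U ^ (j : ℕ) * Q i * Uᴴ ^ (j : ℕ) * X).trace = 0) := by
    rw [LinearMap.mem_ker]
    simp [trMap, pairMap, Prod.ext_iff, funext_iff]
  rw [this]
  tauto

/-- Inclusion of Hermitian tuples. -/
noncomputable def inclMap (n k : ℕ) : (Fin k → selfAdjoint (Matrix (Fin n) (Fin n) ℂ)) →ₗ[ℝ]
    (Fin k → Matrix (Fin n) (Fin n) ℂ) where
  toFun Q i := Q i
  map_add' _ _ := rfl
  map_smul' _ _ := rfl

lemma exists_real {n k l : ℕ} (hn : 0 < n) (hk : n ≤ k) (hl : (n + 1) ^ 2 - 1 ≤ l * k)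
    (hl0 : 0 < l) (U : Matrix (Fin (n + 1)) (Fin (n + 1)) ℂ)
    (hU : U ∈ Matrix.unitaryGroup (Fin (n + 1)) ℂ) (hfeas : UnitaryFeasible U) :
    ∃ Q : Fin k → selfAdjoint (Matrix (Fin (n + 1)) (Fin (n + 1)) ℂ),
      Function.Injective (trMap (n := n + 1) (k := k) (l := l) + pairMap (l := l) U (inclMap _ _ Q)) := by
  obtain ⟨Q, hQ⟩ := exists_complex hn hk hl hl0 U hU hfeas
  rw [← good_iff] at hQ
  let A : Fin k → selfAdjoint (Matrix (Fin (n + 1)) (Fin (n + 1)) ℂ) := fun i => realPart (Q i)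
  let B : Fin k → selfAdjoint (Matrix (Fin (n + 1)) (Fin (n + 1)) ℂ) := fun i =>
    imaginaryPart (Q i)
  have hAB : Q = inclMap _ _ A + Complex.I • inclMap _ _ B := by
    funext i
    exact (realPart_add_I_smul_imaginaryPart (Q i)).symm
  rw [hAB, map_add, map_smul, ← add_assoc] at hQ
  have hf := (pencil_finite_s4 _ _ _ hQ).preimage (f := fun t : ℝ => (t : ℂ))
    (Complex.ofReal_injective.injOn)
  obtain ⟨t, ht⟩ := hf.infinite_compl.nonempty
  simp only [Set.mem_compl_iff, Set.mem_preimage, Set.mem_ofPred_eq, not_not] at ht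
  refine ⟨A + t • B, ?_⟩
  have e : inclMap (n + 1) k (A + t • B) = inclMap _ _ A + (t : ℂ) • inclMap _ _ B := by
    rw [map_add, map_smul]
    rfl
  rw [e, map_add, map_smul, ← add_assoc]
  exact ht

lemma ae_good {n k l : ℕ} (hn : 0 < n) (hk : n ≤ k) (hl : (n + 1) ^ 2 - 1 ≤ l * k)
    (hl0 : 0 < l) (U : Matrix (Fin (n + 1)) (Fin (n + 1)) ℂ)
    (hU : U ∈ Matrix.unitaryGroup (Fin (n + 1)) ℂ) (hfeas : UnitaryFeasible U)
    (μ : Measure (Fin k → selfAdjoint (Matrix (Fin (n + 1)) (Fin (n + 1)) ℂ)))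
    [μ.IsAddHaarMeasure] :
    ∀ᵐ Q : Fin k → selfAdjoint (Matrix (Fin (n + 1)) (Fin (n + 1)) ℂ) ∂μ,
      Function.Injective (trMap (n := n + 1) (k := k) (l := l) + pairMap (l := l) U (inclMap _ _ Q)) := by
  obtain ⟨Q0, hQ0⟩ := exists_real hn hk hl hl0 U hU hfeas
  have b1 : BorelSpace (Matrix (Fin (n + 1)) (Fin (n + 1)) ℂ) :=
    inferInstanceAs (BorelSpace (Fin (n + 1) → Fin (n + 1) → ℂ))
  have sc : SecondCountableTopology (Matrix (Fin (n + 1)) (Fin (n + 1)) ℂ) :=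
    inferInstanceAs (SecondCountableTopology (Fin (n + 1) → Fin (n + 1) → ℂ))
  have b2 : BorelSpace (selfAdjoint (Matrix (Fin (n + 1)) (Fin (n + 1)) ℂ)) :=
    Subtype.borelSpace _
  have fd : FiniteDimensional ℝ (selfAdjoint (Matrix (Fin (n + 1)) (Fin (n + 1)) ℂ)) :=
    inferInstanceAs (FiniteDimensional ℝ
      (selfAdjoint.submodule ℝ (Matrix (Fin (n + 1)) (Fin (n + 1)) ℂ)))
  have sc2 : SecondCountableTopology (selfAdjoint (Matrix (Fin (n + 1)) (Fin (n + 1)) ℂ)) :=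
    TopologicalSpace.Subtype.secondCountableTopology _
  have b3 : BorelSpace (Fin k → selfAdjoint (Matrix (Fin (n + 1)) (Fin (n + 1)) ℂ)) :=
    Pi.borelSpace
  have cs : ContinuousSMul ℝ (selfAdjoint (Matrix (Fin (n + 1)) (Fin (n + 1)) ℂ)) :=
    inferInstanceAs (ContinuousSMul ℝ
      (selfAdjoint.submodule ℝ (Matrix (Fin (n + 1)) (Fin (n + 1)) ℂ)))
  refine ae_injective' μ (trMap (n := n + 1) (k := k) (l := l)) (((pairMap U).restrictScalars ℝ) ∘ₗ inclMap _ _) ?_ Q0 hQ0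
  intro Q s hs h
  change Function.Injective (trMap (n := n + 1) (k := k) (l := l) + pairMap (l := l) U (inclMap _ _ (s • Q))) at h
  change Function.Injective (trMap (n := n + 1) (k := k) (l := l) + pairMap (l := l) U (inclMap _ _ Q))
  rw [good_iff] at h ⊢
  intro X hX hX2
  refine h X hX fun i j => ?_
  have : inclMap (n + 1) k (s • Q) i = (s : ℂ) • inclMap _ _ Q i := rfl
  rw [this]
  simp [hX2 i j]

lemma stable_abs {E ι κ : Type*} [AddCommGroup E] [Module ℝ E] [Fintype ι] [Fintype κ]
    (N : E →ₗ[ℝ] EuclideanSpace ℂ κ) (H : E →ₗ[ℝ] EuclideanSpace ℝ ι)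
    (hH : LinearMap.ker H = ⊥) : ∃ ε > (0 : ℝ), ∀ x, ε * ‖N x‖ ≤ ‖H x‖ := by
  obtain ⟨r, hr⟩ := LinearMap.exists_leftInverse_of_injective _ hH
  let T : EuclideanSpace ℝ ι →L[ℝ] EuclideanSpace ℂ κ := LinearMap.toContinuousLinearMap (N ∘ₗ r)
  have hT : 0 < ‖T‖ + 1 := by positivity
  refine ⟨(‖T‖ + 1)⁻¹, inv_pos.2 hT, fun x => ?_⟩
  have h1 : T (H x) = N x := by
    have := LinearMap.congr_fun hr x
    simp only [LinearMap.comp_apply, LinearMap.id_apply] at this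
    simp [T, this]
  rw [inv_mul_le_iff₀ hT, ← h1]
  refine (T.le_opNorm _).trans ?_
  gcongr
  linarith

lemma stable_of_inj {n : ℕ} {ι : Type*} [Fintype ι] (A : ι → Matrix (Fin n) (Fin n) ℂ)
    (hA : ∀ X : Matrix (Fin n) (Fin n) ℂ, X.IsHermitian → (∀ p, (A p * X).trace.re = 0) → X = 0) :
    ∃ ε > (0 : ℝ), ∀ X : Matrix (Fin n) (Fin n) ℂ, X.IsHermitian →
      ε * frobNorm X ≤ Real.sqrt (∑ p, (A p * X).trace.re ^ 2) := by
  let H : selfAdjoint (Matrix (Fin n) (Fin n) ℂ) →ₗ[ℝ] EuclideanSpace ℝ ι :=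
    { toFun := fun X => WithLp.toLp 2 fun p => (A p * (X : Matrix (Fin n) (Fin n) ℂ)).trace.re
      map_add' := by intro X Y; ext p; simp [Matrix.mul_add]
      map_smul' := by intro c X; ext p; simp }
  let N : selfAdjoint (Matrix (Fin n) (Fin n) ℂ) →ₗ[ℝ] EuclideanSpace ℂ (Fin n × Fin n) :=
    { toFun := fun X => WithLp.toLp 2 fun p => (X : Matrix (Fin n) (Fin n) ℂ) p.1 p.2
      map_add' := by intro X Y; ext p; simp
      map_smul' := by intro c X; ext p; simp }
  have hker : LinearMap.ker H = ⊥ := by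
    rw [Submodule.eq_bot_iff]
    intro X hX
    refine Subtype.ext (hA _ X.2 fun p => ?_)
    exact congrArg (fun v : EuclideanSpace ℝ ι => v p) (LinearMap.mem_ker.1 hX)
  obtain ⟨ε, hε, hb⟩ := stable_abs N H hker
  refine ⟨ε, hε, fun X hX => ?_⟩
  have h1 := hb ⟨X, hX⟩
  rw [EuclideanSpace.norm_eq, EuclideanSpace.norm_eq, Fintype.sum_prod_type] at h1
  simpa [H, N, frobNorm, Complex.normSq_eq_norm_sq] using h1

lemma trace_real {n : ℕ} {A X : Matrix (Fin n) (Fin n) ℂ} (hA : A.IsHermitian)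
    (hX : X.IsHermitian) (h : (A * X).trace.re = 0) : (A * X).trace = 0 := by
  have h1 : star (A * X).trace = (A * X).trace := by
    rw [← Matrix.trace_conjTranspose, Matrix.conjTranspose_mul, hA.eq, hX.eq,
      Matrix.trace_mul_comm]
  have h2 : (A * X).trace.im = 0 := Complex.conj_eq_iff_im.1 h1
  exact Complex.ext h h2

lemma good_imp {n k l : ℕ} (hl0 : 0 < l) (U : Matrix (Fin n) (Fin n) ℂ)
    (Q : Fin k → selfAdjoint (Matrix (Fin n) (Fin n) ℂ))
    (hQ : Function.Injective (trMap (n := n) (k := k) (l := l) + pairMap (l := l) U (inclMap _ _ Q)))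
    (X : Matrix (Fin n) (Fin n) ℂ) (hX : X.IsHermitian)
    (h : ∀ p : Fin (k + 1) × Fin l,
      (U ^ (p.2 : ℕ) * povmExt Q p.1 * Uᴴ ^ (p.2 : ℕ) * X).trace.re = 0) : X = 0 := by
  rw [good_iff] at hQ
  have hsum : ∑ i, povmExt Q i = 1 := by
    rw [Fin.sum_univ_castSucc]
    simp [povmExt]
  refine hQ X ?_ fun i j => ?_
  · have h1 : ∑ i, (povmExt Q i * X).trace.re = 0 :=
      Finset.sum_eq_zero fun i _ => by simpa using h (i, ⟨0, hl0⟩)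
    rw [← Complex.re_sum, ← Matrix.trace_sum, ← Finset.sum_mul, hsum] at h1
    simpa using trace_real Matrix.isHermitian_one hX h1
  · have h1 := h (i.castSucc, j)
    have h2 : povmExt Q i.castSucc = inclMap n k Q i := by
      simp [povmExt, inclMap]
    rw [h2] at h1
    refine trace_real ?_ hX h1
    have h3 : (inclMap n k Q i)ᴴ = inclMap n k Q i := (Q i).2
    rw [Matrix.IsHermitian]
    simp only [Matrix.conjTranspose_mul, Matrix.conjTranspose_pow,
      Matrix.conjTranspose_conjTranspose, h3, Matrix.mul_assoc]

/-- Let `U` be a feasible unitary, `m ≥ n` and `l(m−1) ≥ n²−1`. For almost all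
POVMs `P = (Q_1,…,Q_m)` (identified with a subset of `H(n)^{m-1}`, carrying any Haar (Lebesgue)
measure), the scheme `T_U^l(P)` is stably informationally complete: its probability map
`h(ρ) = (tr(U^j Q_i (U*)^j ρ))_{i,j}` is injective on states, and there is `ε > 0` such that
every scheme of the same format (a tuple of `l` POVMs with `m` outcomes) whose probability map
`h'` satisfies `‖h − h'‖ < ε` (operator norm w.r.t. the Frobenius norm on `H(n)` and the
Euclidean norm on `ℝ^{ml}`) is also injective on states. -/
theorem stmt4 {n m l : ℕ} (hm : n ≤ m) (hl : n ^ 2 - 1 ≤ l * (m - 1))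
    (U : Matrix (Fin n) (Fin n) ℂ)
    (hU : U ∈ Matrix.unitaryGroup (Fin n) ℂ) (hfeas : UnitaryFeasible U)
    (μ : Measure (Fin (m - 1) → selfAdjoint (Matrix (Fin n) (Fin n) ℂ)))
    [μ.IsAddHaarMeasure] :
    μ {Q | IsPOVM (povmExt Q) ∧
        ¬ (Set.InjOn
            (fun ρ : Matrix (Fin n) (Fin n) ℂ => fun p : Fin (m - 1 + 1) × Fin l =>
              (U ^ (p.2 : ℕ) * povmExt Q p.1 * Uᴴ ^ (p.2 : ℕ) * ρ).trace.re)
            {ρ | IsState ρ} ∧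
          ∃ ε > (0 : ℝ), ∀ P' : Fin l → Fin (m - 1 + 1) → Matrix (Fin n) (Fin n) ℂ,
            (∀ j, IsPOVM (P' j)) →
            (∀ X : Matrix (Fin n) (Fin n) ℂ, X.IsHermitian → X ≠ 0 →
              Real.sqrt (∑ p : Fin (m - 1 + 1) × Fin l,
                  ((P' p.2 p.1 * X).trace.re
                    - (U ^ (p.2 : ℕ) * povmExt Q p.1 * Uᴴ ^ (p.2 : ℕ) * X).trace.re) ^ 2)
                < ε * frobNorm X) →
            Set.InjOn
              (fun ρ : Matrix (Fin n) (Fin n) ℂ => fun p : Fin (m - 1 + 1) × Fin l =>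
                (P' p.2 p.1 * ρ).trace.re)
              {ρ | IsState ρ})} = 0 := by
  rcases Nat.lt_or_ge n 2 with hn | hn
  · -- at most one state
    have hsub : ∀ ρ σ : Matrix (Fin n) (Fin n) ℂ, IsState ρ → IsState σ → ρ = σ := by
      intro ρ σ hρ hσ
      have h1 := hρ.2
      have h2 := hσ.2
      interval_cases n
      · ext i; exact i.elim0
      · ext i j
        rw [Subsingleton.elim i 0, Subsingleton.elim j 0]
        simp [Matrix.trace] at h1 h2
        rw [h1, h2]
    convert measure_empty (μ := μ)
    rw [Set.eq_empty_iff_forall_notMem]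
    rintro Q ⟨-, hQ⟩
    exact hQ ⟨fun ρ hρ σ hσ _ => hsub ρ σ hρ hσ, 1, one_pos,
      fun _ _ _ ρ hρ σ hσ _ => hsub ρ σ hρ hσ⟩
  obtain ⟨n, rfl⟩ : ∃ n', n = n' + 1 := ⟨n - 1, by omega⟩
  have hl0 : 0 < l := by
    rcases Nat.eq_zero_or_pos l with rfl | h
    · exfalso
      have : 2 ^ 2 ≤ (n + 1) ^ 2 := Nat.pow_le_pow_left hn 2
      omega
    · exact h
  have hae := ae_good (k := m - 1) (by omega) (by omega) hl hl0 U hU hfeas μ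
  rw [ae_iff] at hae
  refine measure_mono_null ?_ hae
  rintro Q ⟨-, hQ⟩ hgood
  apply hQ
  have hinj := good_imp hl0 U Q hgood
  obtain ⟨ε, hε, hb⟩ := stable_of_inj
    (fun p : Fin (m - 1 + 1) × Fin l => U ^ (p.2 : ℕ) * povmExt Q p.1 * Uᴴ ^ (p.2 : ℕ)) hinj
  have hsubH : ∀ ρ σ : Matrix (Fin (n + 1)) (Fin (n + 1)) ℂ, IsState ρ → IsState σ →
      (ρ - σ).IsHermitian := fun ρ σ hρ hσ => hρ.1.isHermitian.sub hσ.1.isHermitian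
  refine ⟨fun ρ hρ σ hσ h => ?_, ε, hε, fun P' _ hP ρ hρ σ hσ h => ?_⟩
  · refine sub_eq_zero.1 (hinj _ (hsubH ρ σ hρ hσ) fun p => ?_)
    have := congrFun h p
    simp only at this
    rw [Matrix.mul_sub, Matrix.trace_sub, Complex.sub_re, this, sub_self]
  · by_contra hne
    have h1 := hP _ (hsubH ρ σ hρ hσ) (sub_ne_zero.2 hne)
    have h2 := hb _ (hsubH ρ σ hρ hσ)
    have h3 : ∀ p : Fin (m - 1 + 1) × Fin l, (P' p.2 p.1 * (ρ - σ)).trace.re = 0 := by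
      intro p
      have := congrFun h p
      simp only at this
      rw [Matrix.mul_sub, Matrix.trace_sub, Complex.sub_re, this, sub_self]
    simp only [h3, zero_sub, neg_sq] at h1
    exact absurd h1 (not_lt.2 h2)
end
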